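/- Let m ≥ 1 be an integer and let m₁, m₂, m₃ ≥ 0 be integers with m̃ := m₁ + m₂ + m₃ ≤ 2m − 2. Fix partial derivative operators Dᵢ = ∂_x^{m_{i1}}∂_y^{m_{i2}} with m_{i1} + m_{i2} = mᵢ for i = 1, 2, 3. Then there exists a constant c > 0, depending only on m, such that for every smooth periodic function u : ℝ² → ℝ, ‖(D₁u)(D₂u)(D₃u)‖ ≤ c ‖A^{m+1}u‖^{(m̃+2)/(2(m+1))} ‖u‖^{(6m−m̃+4)/(2(m+1))}. -/

import Mathlib

open MeasureTheory Real Filter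

noncomputable section

/-- A function `u : ℝ² → ℝ` is smooth periodic if it is `C^∞` and `2π`-periodic
in each variable. -/
def SmoothPeriodic (u : ℝ × ℝ → ℝ) : Prop :=
  ContDiff ℝ (⊤ : ℕ∞) u ∧ (∀ x y, u (x + 2 * Real.pi, y) = u (x, y)) ∧
    (∀ x y, u (x, y + 2 * Real.pi) = u (x, y))

/-- Partial derivative in the first variable. -/
def pdx (u : ℝ × ℝ → ℝ) : ℝ × ℝ → ℝ := fun p => fderiv ℝ u p (1, 0)

/-- Partial derivative in the second variable. -/
def pdy (u : ℝ × ℝ → ℝ) : ℝ × ℝ → ℝ := fun p => fderiv ℝ u p (0, 1)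

/-- The fundamental domain `[0, 2π]²`. -/
def sq2 : Set (ℝ × ℝ) := Set.Icc (0 : ℝ) (2 * Real.pi) ×ˢ Set.Icc (0 : ℝ) (2 * Real.pi)

/-- The `L²` inner product over `[0, 2π]²`. -/
def l2inner (u v : ℝ × ℝ → ℝ) : ℝ := ∫ p in sq2, u p * v p

/-- The `L²` norm over `[0, 2π]²`. -/
def l2norm (u : ℝ × ℝ → ℝ) : ℝ := Real.sqrt (∫ p in sq2, (u p) ^ 2)

/-- The `L^q` norm over `[0, 2π]²`. -/
def lpnorm (q : ℝ) (u : ℝ × ℝ → ℝ) : ℝ := (∫ p in sq2, |u p| ^ q) ^ (1 / q)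

/-- The operator `A = -Δ + 1`. -/
def Aop (u : ℝ × ℝ → ℝ) : ℝ × ℝ → ℝ :=
  fun p => -(pdx (pdx u) p + pdy (pdy u) p) + u p

/-- The pointwise dot product of gradients, `∇v ⋅ ∇w`. -/
def gradDot (v w : ℝ × ℝ → ℝ) : ℝ × ℝ → ℝ :=
  fun p => pdx v p * pdx w p + pdy v p * pdy w p

/-- The nonlinearity `f(u) = (a+3)u − 4Au + b|∇u|² + u³`. -/
def fNL (a b : ℝ) (u : ℝ × ℝ → ℝ) : ℝ × ℝ → ℝ :=
  fun p => (a + 3) * u p - 4 * Aop u p + b * gradDot u u p + (u p) ^ 3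

lemma SmoothPeriodic.fderiv_apply {u : ℝ × ℝ → ℝ} (hu : SmoothPeriodic u) (e : ℝ × ℝ) :
    SmoothPeriodic (fun p => fderiv ℝ u p e) := by
  obtain ⟨h, hx, hy⟩ := hu
  refine ⟨(h.fderiv_right (m := (⊤ : ℕ∞)) (by simp)).clm_apply contDiff_const,
    fun x y => ?_, fun x y => ?_⟩
  · have : (fun p : ℝ × ℝ => u (p + (2 * π, 0))) = u := by
      funext ⟨a, b⟩; simpa using hx a b
    have h2 := fderiv_comp_add_right (𝕜 := ℝ) (f := u) (x := (x, y)) ((2 * π, 0) : ℝ × ℝ)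
    rw [this] at h2
    simpa using congrArg (fun L => L e) h2.symm
  · have : (fun p : ℝ × ℝ => u (p + (0, 2 * π))) = u := by
      funext ⟨a, b⟩; simpa using hy a b
    have h2 := fderiv_comp_add_right (𝕜 := ℝ) (f := u) (x := (x, y)) ((0, 2 * π) : ℝ × ℝ)
    rw [this] at h2
    simpa using congrArg (fun L => L e) h2.symm

lemma SmoothPeriodic.pdx {u : ℝ × ℝ → ℝ} (hu : SmoothPeriodic u) : SmoothPeriodic (pdx u) :=
  hu.fderiv_apply (1, 0)

lemma SmoothPeriodic.pdy {u : ℝ × ℝ → ℝ} (hu : SmoothPeriodic u) : SmoothPeriodic (pdy u) :=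
  hu.fderiv_apply (0, 1)

lemma SmoothPeriodic.add {u v : ℝ × ℝ → ℝ} (hu : SmoothPeriodic u) (hv : SmoothPeriodic v) :
    SmoothPeriodic (u + v) :=
  ⟨hu.1.add hv.1, fun x y => by simp [hu.2.1 x y, hv.2.1 x y],
    fun x y => by simp [hu.2.2 x y, hv.2.2 x y]⟩

lemma SmoothPeriodic.mul {u v : ℝ × ℝ → ℝ} (hu : SmoothPeriodic u) (hv : SmoothPeriodic v) :
    SmoothPeriodic (u * v) :=
  ⟨hu.1.mul hv.1, fun x y => by simp [hu.2.1 x y, hv.2.1 x y],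
    fun x y => by simp [hu.2.2 x y, hv.2.2 x y]⟩

lemma SmoothPeriodic.smul {u : ℝ × ℝ → ℝ} (hu : SmoothPeriodic u) (t : ℝ) :
    SmoothPeriodic (t • u) :=
  ⟨hu.1.const_smul t, fun x y => by simp [hu.2.1 x y], fun x y => by simp [hu.2.2 x y]⟩

lemma SmoothPeriodic.differentiable {u : ℝ × ℝ → ℝ} (hu : SmoothPeriodic u) :
    Differentiable ℝ u := hu.1.differentiable (by simp)

lemma SmoothPeriodic.continuous {u : ℝ × ℝ → ℝ} (hu : SmoothPeriodic u) : Continuous u :=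
  hu.1.continuous

lemma Aop_eq (u : ℝ × ℝ → ℝ) :
    Aop u = (-1 : ℝ) • (pdx (pdx u) + pdy (pdy u)) + u := by
  funext p; simp [Aop]; ring

lemma SmoothPeriodic.Aop {u : ℝ × ℝ → ℝ} (hu : SmoothPeriodic u) : SmoothPeriodic (Aop u) := by
  rw [Aop_eq]
  exact ((hu.pdx.pdx.add hu.pdy.pdy).smul _).add hu

lemma pdx_add {u v : ℝ × ℝ → ℝ} (hu : SmoothPeriodic u) (hv : SmoothPeriodic v) :
    pdx (u + v) = pdx u + pdx v := by
  funext p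
  simp [pdx, fderiv_add (hu.differentiable p) (hv.differentiable p)]

lemma pdy_add {u v : ℝ × ℝ → ℝ} (hu : SmoothPeriodic u) (hv : SmoothPeriodic v) :
    pdy (u + v) = pdy u + pdy v := by
  funext p
  simp [pdy, fderiv_add (hu.differentiable p) (hv.differentiable p)]

lemma pdx_smul {u : ℝ × ℝ → ℝ} (hu : SmoothPeriodic u) (t : ℝ) :
    pdx (t • u) = t • pdx u := by
  funext p
  simp [pdx, fderiv_const_smul (hu.differentiable p)]

lemma pdy_smul {u : ℝ × ℝ → ℝ} (hu : SmoothPeriodic u) (t : ℝ) :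
    pdy (t • u) = t • pdy u := by
  funext p
  simp [pdy, fderiv_const_smul (hu.differentiable p)]

lemma pdx_mul {u v : ℝ × ℝ → ℝ} (hu : SmoothPeriodic u) (hv : SmoothPeriodic v) :
    pdx (u * v) = pdx u * v + u * pdx v := by
  funext p
  simp [pdx, fderiv_mul (hu.differentiable p) (hv.differentiable p)]
  ring

lemma pdy_mul {u v : ℝ × ℝ → ℝ} (hu : SmoothPeriodic u) (hv : SmoothPeriodic v) :
    pdy (u * v) = pdy u * v + u * pdy v := by
  funext p
  simp [pdy, fderiv_mul (hu.differentiable p) (hv.differentiable p)]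
  ring

lemma pdx_pdy_comm {u : ℝ × ℝ → ℝ} (hu : SmoothPeriodic u) :
    pdx (pdy u) = pdy (pdx u) := by
  funext p
  have hd : DifferentiableAt ℝ (fderiv ℝ u) p :=
    (hu.1.fderiv_right (m := (⊤ : ℕ∞)) (by simp)).differentiable (by simp) p
  have hsym : IsSymmSndFDerivAt ℝ u p :=
    hu.1.contDiffAt.isSymmSndFDerivAt (by
      simpa using (WithTop.coe_le_coe.2 le_top : ((2 : ℕ∞) : WithTop ℕ∞) ≤ (⊤ : ℕ∞)))
  change fderiv ℝ (fun q => fderiv ℝ u q (0, 1)) p (1, 0)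
    = fderiv ℝ (fun q => fderiv ℝ u q (1, 0)) p (0, 1)
  rw [fderiv_clm_apply hd (differentiableAt_const _),
    fderiv_clm_apply hd (differentiableAt_const _)]
  simpa using hsym (1, 0) (0, 1)

lemma Aop_pdx {u : ℝ × ℝ → ℝ} (hu : SmoothPeriodic u) : Aop (pdx u) = pdx (Aop u) := by
  rw [Aop_eq, Aop_eq, pdx_add ((hu.pdx.pdx.add hu.pdy.pdy).smul _) hu,
    pdx_smul (hu.pdx.pdx.add hu.pdy.pdy), pdx_add hu.pdx.pdx hu.pdy.pdy,
    pdx_pdy_comm hu.pdy, pdx_pdy_comm hu]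

lemma Aop_pdy {u : ℝ × ℝ → ℝ} (hu : SmoothPeriodic u) : Aop (pdy u) = pdy (Aop u) := by
  rw [Aop_eq, Aop_eq, pdy_add ((hu.pdx.pdx.add hu.pdy.pdy).smul _) hu,
    pdy_smul (hu.pdx.pdx.add hu.pdy.pdy), pdy_add hu.pdx.pdx hu.pdy.pdy,
    pdx_pdy_comm hu, pdx_pdy_comm hu.pdx]

lemma hasDerivAt_fst {u : ℝ × ℝ → ℝ} (hu : SmoothPeriodic u) (x y : ℝ) :
    HasDerivAt (fun s => u (s, y)) (pdx u (x, y)) x :=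
  (hu.differentiable (x, y)).hasFDerivAt.comp_hasDerivAt x
    ((hasDerivAt_id x).prodMk (hasDerivAt_const x y))

lemma hasDerivAt_snd {u : ℝ × ℝ → ℝ} (hu : SmoothPeriodic u) (x y : ℝ) :
    HasDerivAt (fun s => u (x, s)) (pdy u (x, y)) y :=
  (hu.differentiable (x, y)).hasFDerivAt.comp_hasDerivAt y
    ((hasDerivAt_const y x).prodMk (hasDerivAt_id y))

lemma measurableSet_sq2 : MeasurableSet sq2 := measurableSet_Icc.prod measurableSet_Icc

lemma integrableOn_sq2 {f : ℝ × ℝ → ℝ} (hf : Continuous f) : IntegrableOn f sq2 :=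
  hf.continuousOn.integrableOn_compact (isCompact_Icc.prod isCompact_Icc)

lemma integral_sq2_add {f g : ℝ × ℝ → ℝ} (hf : Continuous f) (hg : Continuous g) :
    ∫ p in sq2, (f p + g p) = (∫ p in sq2, f p) + ∫ p in sq2, g p :=
  integral_add (integrableOn_sq2 hf) (integrableOn_sq2 hg)

lemma integral_sq2 {f : ℝ × ℝ → ℝ} (hf : Continuous f) :
    ∫ p in sq2, f p = ∫ x in (0 : ℝ)..2 * π, ∫ y in (0 : ℝ)..2 * π, f (x, y) := by
  have h := integrableOn_sq2 hf
  rw [sq2, Measure.volume_eq_prod] at *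
  rw [setIntegral_prod _ h, intervalIntegral.integral_of_le (by positivity),
    integral_Icc_eq_integral_Ioc]
  simp_rw [intervalIntegral.integral_of_le (show (0 : ℝ) ≤ 2 * π by positivity),
    integral_Icc_eq_integral_Ioc]

lemma integral_sq2_swap {f : ℝ × ℝ → ℝ} (hf : Continuous f) :
    ∫ p in sq2, f p = ∫ y in (0 : ℝ)..2 * π, ∫ x in (0 : ℝ)..2 * π, f (x, y) := by
  rw [← integral_sq2 (f := fun p => f (p.2, p.1)) (by fun_prop), sq2, Measure.volume_eq_prod,
    ← setIntegral_prod_swap]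
  rfl

lemma integral_pdx_eq_zero {u : ℝ × ℝ → ℝ} (hu : SmoothPeriodic u) :
    ∫ p in sq2, pdx u p = 0 := by
  have hc := hu.pdx.continuous
  rw [integral_sq2_swap hc]
  refine (intervalIntegral.integral_congr (g := fun _ => 0) fun y _ => ?_).trans (by simp)
  have h := intervalIntegral.integral_eq_sub_of_hasDerivAt (a := 0) (b := 2 * π)
    (fun x _ => hasDerivAt_fst hu x y)
    ((by fun_prop : Continuous fun x => pdx u (x, y)).intervalIntegrable _ _)
  have h2 := hu.2.1 0 y
  rw [zero_add] at h2
  simpa [h2] using h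

lemma integral_pdy_eq_zero {u : ℝ × ℝ → ℝ} (hu : SmoothPeriodic u) :
    ∫ p in sq2, pdy u p = 0 := by
  have hc := hu.pdy.continuous
  rw [integral_sq2 hc]
  refine (intervalIntegral.integral_congr (g := fun _ => 0) fun x _ => ?_).trans (by simp)
  have h := intervalIntegral.integral_eq_sub_of_hasDerivAt (a := 0) (b := 2 * π)
    (fun y _ => hasDerivAt_snd hu x y)
    ((by fun_prop : Continuous fun y => pdy u (x, y)).intervalIntegrable _ _)
  have h2 := hu.2.2 x 0
  rw [zero_add] at h2
  simpa [h2] using h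

/-- The bilinear form `⟨Aʲ v, w⟩`, written without integrating by parts. -/
def sobolevForm : ℕ → (ℝ × ℝ → ℝ) → (ℝ × ℝ → ℝ) → ℝ
  | 0, v, w => l2inner v w
  | j + 1, v, w =>
    sobolevForm j v w + sobolevForm j (pdx v) (pdx w) + sobolevForm j (pdy v) (pdy w)

lemma sobolevForm_self_nonneg (j : ℕ) (v : ℝ × ℝ → ℝ) : 0 ≤ sobolevForm j v v := by
  induction j generalizing v with
  | zero => exact integral_nonneg fun p => mul_self_nonneg _
  | succ j ih => exact add_nonneg (add_nonneg (ih _) (ih _)) (ih _)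

lemma sobolevForm_comm (j : ℕ) (v w : ℝ × ℝ → ℝ) : sobolevForm j v w = sobolevForm j w v := by
  induction j generalizing v w with
  | zero => simp only [sobolevForm, l2inner, mul_comm]
  | succ j ih => simp only [sobolevForm, ih v w, ih (pdx v), ih (pdy v)]

lemma l2inner_add_smul_self {v w : ℝ × ℝ → ℝ} (hv : Continuous v) (hw : Continuous w) (t : ℝ) :
    l2inner (v + t • w) (v + t • w) = l2inner w w * (t * t) + 2 * l2inner v w * t
      + l2inner v v := by
  simp only [l2inner]
  calc _ = ∫ p in sq2, ((t * t) * (w p * w p) + (2 * t) * (v p * w p) + v p * v p) := by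
        congr 1; funext p; simp; ring
    _ = _ := by
        rw [integral_sq2_add (by fun_prop) (by fun_prop),
          integral_sq2_add (by fun_prop) (by fun_prop), integral_const_mul, integral_const_mul]
        ring

lemma l2inner_sq_le {v w : ℝ × ℝ → ℝ} (hv : Continuous v) (hw : Continuous w) :
    l2inner v w ^ 2 ≤ l2inner v v * l2inner w w := by
  have h := discrim_le_zero (a := l2inner w w) (b := 2 * l2inner v w) (c := l2inner v v)
    fun t => by
      rw [← l2inner_add_smul_self hv hw]
      exact sobolevForm_self_nonneg 0 _
  rw [discrim] at h
  linarith

lemma sobolevForm_add_smul_self (j : ℕ) {v w : ℝ × ℝ → ℝ} (hv : SmoothPeriodic v)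
    (hw : SmoothPeriodic w) (t : ℝ) :
    sobolevForm j (v + t • w) (v + t • w) = sobolevForm j w w * (t * t)
      + 2 * sobolevForm j v w * t + sobolevForm j v v := by
  induction j generalizing v w with
  | zero => exact l2inner_add_smul_self hv.continuous hw.continuous t
  | succ j ih =>
    simp only [sobolevForm]
    rw [pdx_add hv (hw.smul t), pdy_add hv (hw.smul t), pdx_smul hw, pdy_smul hw, ih hv hw,
      ih hv.pdx hw.pdx, ih hv.pdy hw.pdy]
    ring

lemma sobolevForm_sq_le (j : ℕ) {v w : ℝ × ℝ → ℝ} (hv : SmoothPeriodic v)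
    (hw : SmoothPeriodic w) :
    sobolevForm j v w ^ 2 ≤ sobolevForm j v v * sobolevForm j w w := by
  have h := discrim_le_zero (a := sobolevForm j w w) (b := 2 * sobolevForm j v w)
    (c := sobolevForm j v v) fun t => by
      rw [← sobolevForm_add_smul_self j hv hw]
      exact sobolevForm_self_nonneg j _
  rw [discrim] at h
  linarith

lemma l2inner_pdx {v w : ℝ × ℝ → ℝ} (hv : SmoothPeriodic v) (hw : SmoothPeriodic w) :
    l2inner v (pdx w) = -l2inner (pdx v) w := by
  have h := integral_pdx_eq_zero (hv.mul hw)
  rw [pdx_mul hv hw] at h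
  have h' := integral_add (integrableOn_sq2 (hv.pdx.mul hw).continuous)
    (integrableOn_sq2 (hv.mul hw.pdx).continuous)
  simp only [Pi.add_apply, Pi.mul_apply] at h h'
  simp only [l2inner]
  linarith

lemma l2inner_pdy {v w : ℝ × ℝ → ℝ} (hv : SmoothPeriodic v) (hw : SmoothPeriodic w) :
    l2inner v (pdy w) = -l2inner (pdy v) w := by
  have h := integral_pdy_eq_zero (hv.mul hw)
  rw [pdy_mul hv hw] at h
  have h' := integral_add (integrableOn_sq2 (hv.pdy.mul hw).continuous)
    (integrableOn_sq2 (hv.mul hw.pdy).continuous)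
  simp only [Pi.add_apply, Pi.mul_apply] at h h'
  simp only [l2inner]
  linarith

lemma sobolevForm_succ_eq_Aop (j : ℕ) {v w : ℝ × ℝ → ℝ} (hv : SmoothPeriodic v)
    (hw : SmoothPeriodic w) : sobolevForm (j + 1) v w = sobolevForm j (Aop v) w := by
  induction j generalizing v w with
  | zero =>
    simp only [sobolevForm]
    rw [l2inner_pdx hv.pdx hw, l2inner_pdy hv.pdy hw]
    have h1 := integrableOn_sq2 (hv.pdx.pdx.mul hw).continuous
    have h2 := integrableOn_sq2 (hv.pdy.pdy.mul hw).continuous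
    have h3 := integrableOn_sq2 (hv.mul hw).continuous
    have h4 := integral_add (h1.add h2).neg h3
    have h5 := integral_add h1 h2
    have h6 := integral_neg (μ := volume.restrict sq2) (pdx (pdx v) * w + pdy (pdy v) * w)
    simp only [Pi.add_apply, Pi.mul_apply, Pi.neg_apply] at h4 h5 h6
    have h7 : l2inner (Aop v) w = ∫ p in sq2, (-(pdx (pdx v) p * w p + pdy (pdy v) p * w p)
        + v p * w p) := by
      rw [l2inner]; congr 1; funext p; simp only [Aop]; ring
    rw [h7, h4, h6, h5]
    simp only [l2inner]
    ring
  | succ j ih =>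
    rw [sobolevForm, ih hv hw, ih hv.pdx hw.pdx, ih hv.pdy hw.pdy, Aop_pdx hv, Aop_pdy hv]
    rfl

lemma sobolevForm_add_two_self (j : ℕ) {v : ℝ × ℝ → ℝ} (hv : SmoothPeriodic v) :
    sobolevForm (j + 2) v v = sobolevForm j (Aop v) (Aop v) := by
  rw [sobolevForm_succ_eq_Aop _ hv hv, sobolevForm_comm, sobolevForm_succ_eq_Aop _ hv hv.Aop]

lemma sobolevForm_two_mul_self (n : ℕ) {v : ℝ × ℝ → ℝ} (hv : SmoothPeriodic v) :
    sobolevForm (2 * n) v v = l2norm (Aop^[n] v) ^ 2 := by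
  induction n generalizing v with
  | zero =>
    rw [l2norm, Real.sq_sqrt (integral_nonneg fun p => sq_nonneg _)]
    simp [sobolevForm, l2inner, sq]
  | succ n ih =>
    rw [mul_add, sobolevForm_add_two_self _ hv, ih hv.Aop, Function.iterate_succ_apply]

lemma sobolevForm_logConvex (j : ℕ) {v : ℝ × ℝ → ℝ} (hv : SmoothPeriodic v) :
    sobolevForm (j + 1) v v ^ 2 ≤ sobolevForm j v v * sobolevForm (j + 2) v v := by
  rw [sobolevForm_add_two_self _ hv, sobolevForm_succ_eq_Aop _ hv hv, mul_comm]
  exact sobolevForm_sq_le j hv.Aop hv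

lemma sobolevForm_le_succ (j : ℕ) (v : ℝ × ℝ → ℝ) :
    sobolevForm j v v ≤ sobolevForm (j + 1) v v := by
  simp only [sobolevForm]
  linarith [sobolevForm_self_nonneg j (pdx v), sobolevForm_self_nonneg j (pdy v)]

lemma sobolevForm_pdx_le (j : ℕ) (v : ℝ × ℝ → ℝ) :
    sobolevForm j (pdx v) (pdx v) ≤ sobolevForm (j + 1) v v := by
  simp only [sobolevForm]
  linarith [sobolevForm_self_nonneg j v, sobolevForm_self_nonneg j (pdy v)]

lemma sobolevForm_pdy_le (j : ℕ) (v : ℝ × ℝ → ℝ) :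
    sobolevForm j (pdy v) (pdy v) ≤ sobolevForm (j + 1) v v := by
  simp only [sobolevForm]
  linarith [sobolevForm_self_nonneg j v, sobolevForm_self_nonneg j (pdx v)]

lemma sobolevForm_iterate_le (j a b : ℕ) (v : ℝ × ℝ → ℝ) :
    sobolevForm j (pdx^[a] (pdy^[b] v)) (pdx^[a] (pdy^[b] v)) ≤ sobolevForm (a + b + j) v v := by
  induction a generalizing j with
  | zero =>
    induction b generalizing j with
    | zero => simp
    | succ b ih =>
      simp only [Function.iterate_zero, id, Function.iterate_succ_apply'] at ih ⊢
      refine (sobolevForm_pdy_le j _).trans ((ih (j + 1)).trans_eq ?_)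
      congr 1; ring
  | succ a ih =>
    rw [Function.iterate_succ_apply']
    refine (sobolevForm_pdx_le j _).trans ((ih (j + 1)).trans_eq ?_)
    congr 1; ring

lemma SmoothPeriodic.iterate {v : ℝ × ℝ → ℝ} (hv : SmoothPeriodic v) (a b : ℕ) :
    SmoothPeriodic (_root_.pdx^[a] (_root_.pdy^[b] v)) := by
  induction a with
  | zero =>
    induction b with
    | zero => exact hv
    | succ b ih =>
      simp only [Function.iterate_zero, id, Function.iterate_succ_apply'] at ih ⊢
      exact ih.pdy
  | succ a ih => rw [Function.iterate_succ_apply']; exact ih.pdx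

lemma abs_le_integral_abs_add_integral_abs_deriv {g g' : ℝ → ℝ}
    (hg : ∀ x, HasDerivAt g (g' x) x) (hg' : Continuous g') {x : ℝ}
    (hx : x ∈ Set.Icc 0 (2 * π)) :
    |g x| ≤ ∫ t in (0 : ℝ)..2 * π, (|g t| + |g' t|) := by
  have hπ : (0 : ℝ) ≤ 2 * π := by positivity
  have hgc : Continuous g := continuous_iff_continuousAt.2 fun x => (hg x).continuousAt
  set K := ∫ t in (0 : ℝ)..2 * π, |g' t| with hK
  have hpt : ∀ t ∈ Set.Icc 0 (2 * π), |g x| ≤ |g t| + K := by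
    intro t ht
    have h := intervalIntegral.integral_eq_sub_of_hasDerivAt (a := t) (b := x)
      (fun s _ => hg s) (hg'.intervalIntegrable _ _)
    have h2 : |∫ s in t..x, g' s| ≤ K := by
      refine (intervalIntegral.norm_integral_le_integral_norm_uIoc (f := g') (μ := volume)).trans ?_
      rw [hK, intervalIntegral.integral_of_le hπ]
      refine setIntegral_mono_set ?_ (ae_of_all _ fun _ => abs_nonneg _) ?_
      · exact (hg'.abs.integrableOn_Icc).mono_set Set.Ioc_subset_Icc_self
      · refine (LE.le.eventuallyLE fun s hs => ?_)
        exact ⟨(le_min ht.1 hx.1).trans_lt hs.1, hs.2.trans (max_le ht.2 hx.2)⟩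
    rw [h] at h2
    have := abs_sub_abs_le_abs_sub (g x) (g t)
    linarith
  have hint := intervalIntegral.integral_mono_on hπ
    (intervalIntegrable_const (μ := volume) (c := |g x|))
    ((by fun_prop : Continuous fun t => |g t| + K).intervalIntegrable 0 (2 * π)) hpt
  rw [intervalIntegral.integral_add (hgc.abs.intervalIntegrable _ _) (by simp),
    intervalIntegral.integral_const, intervalIntegral.integral_const] at hint
  rw [intervalIntegral.integral_add (hgc.abs.intervalIntegrable _ _)
    (hg'.abs.intervalIntegrable _ _), ← hK]
  have h0 : 0 ≤ ∫ t in (0 : ℝ)..2 * π, |g t| :=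
    intervalIntegral.integral_nonneg hπ fun _ _ => abs_nonneg _
  simp only [sub_zero, smul_eq_mul] at hint
  have hπ1 : (1 : ℝ) ≤ 2 * π := by linarith [Real.pi_gt_three]
  nlinarith

lemma abs_le_integral_mixed {W : ℝ × ℝ → ℝ} (hW : SmoothPeriodic W) {p : ℝ × ℝ}
    (hp : p ∈ sq2) :
    |W p| ≤ ∫ q in sq2, (|W q| + |pdy W q| + |pdx W q| + |pdy (pdx W) q|) := by
  obtain ⟨x, y⟩ := p
  have hπ : (0 : ℝ) ≤ 2 * π := by positivity
  have c0 := hW.continuous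
  have cx := hW.pdx.continuous
  have cy := hW.pdy.continuous
  have cxy := hW.pdx.pdy.continuous
  have h1 := abs_le_integral_abs_add_integral_abs_deriv (fun s => hasDerivAt_fst hW s y)
    (by fun_prop) hp.1
  refine h1.trans ?_
  rw [integral_sq2 (by fun_prop)]
  refine intervalIntegral.integral_mono_on hπ
    ((by fun_prop : Continuous _).intervalIntegrable _ _)
    ((by fun_prop : Continuous _).intervalIntegrable _ _) fun s _ => ?_
  have h2 := abs_le_integral_abs_add_integral_abs_deriv (fun t => hasDerivAt_snd hW s t)
    (by fun_prop) hp.2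
  have h3 := abs_le_integral_abs_add_integral_abs_deriv (fun t => hasDerivAt_snd hW.pdx s t)
    (by fun_prop) hp.2
  refine (add_le_add h2 h3).trans_eq ?_
  rw [← intervalIntegral.integral_add ((by fun_prop : Continuous _).intervalIntegrable _ _)
    ((by fun_prop : Continuous _).intervalIntegrable _ _)]
  simp only [add_assoc]

lemma l2inner_abs_le_sqrt {v w : ℝ × ℝ → ℝ} (hv : Continuous v) (hw : Continuous w) :
    l2inner |v| |w| ≤ √(l2inner v v * l2inner w w) := by
  have h := l2inner_sq_le hv.abs hw.abs
  refine Real.le_sqrt_of_sq_le (h.trans_eq ?_)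
  simp [l2inner]

/-- Agmon's inequality on the two-dimensional torus. -/
lemma sq_le_sqrt_sobolevForm {v : ℝ × ℝ → ℝ} (hv : SmoothPeriodic v) {p : ℝ × ℝ}
    (hp : p ∈ sq2) :
    v p ^ 2 ≤ 9 * √(sobolevForm 0 v v * sobolevForm 2 v v) := by
  set T := √(sobolevForm 0 v v * sobolevForm 2 v v)
  have n0 := sobolevForm_self_nonneg 0 v
  have n1 := sobolevForm_self_nonneg 1 v
  have m0 := sobolevForm_le_succ 0 v
  have m1 := sobolevForm_le_succ 1 v
  have hT1 : sobolevForm 1 v v ≤ T := Real.le_sqrt_of_sq_le (sobolevForm_logConvex 0 hv)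
  have bound : ∀ w, SmoothPeriodic w → l2inner w w ≤ sobolevForm 2 v v →
      l2inner |v| |w| ≤ T := fun w hw h =>
    (l2inner_abs_le_sqrt hv.continuous hw.continuous).trans
      (Real.sqrt_le_sqrt (mul_le_mul_of_nonneg_left h n0))
  have b0 := bound v hv (m0.trans m1)
  have bx := bound _ hv.pdx ((sobolevForm_pdx_le 0 v).trans m1)
  have bY := bound _ hv.pdy ((sobolevForm_pdy_le 0 v).trans m1)
  have bxy := bound _ hv.pdx.pdy ((sobolevForm_pdy_le 0 _).trans (sobolevForm_pdx_le 1 v))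
  have bb : l2inner |pdx v| |pdy v| ≤ T := by
    refine (l2inner_abs_le_sqrt hv.pdx.continuous hv.pdy.continuous).trans (le_trans ?_ hT1)
    refine Real.sqrt_le_iff.2 ⟨n1, ?_⟩
    rw [sq]
    exact mul_le_mul (sobolevForm_pdx_le 0 v) (sobolevForm_pdy_le 0 v)
      (sobolevForm_self_nonneg 0 _) n1
  have c0 := hv.continuous
  have cx := hv.pdx.continuous
  have cy := hv.pdy.continuous
  have cxy := hv.pdx.pdy.continuous
  have h := abs_le_integral_mixed (hv.mul hv) hp
  have hle : ∫ q in sq2, (|(v * v) q| + |pdy (v * v) q| + |pdx (v * v) q|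
      + |pdy (pdx (v * v)) q|) ≤ ∫ q in sq2, (|v q| * |v q| + 2 * (|v q| * |pdy v q|)
      + 2 * (|v q| * |pdx v q|) + 2 * (|pdx v q| * |pdy v q|)
      + 2 * (|v q| * |pdy (pdx v) q|)) := by
    have cW := (hv.mul hv).continuous
    have cWx := (hv.mul hv).pdx.continuous
    have cWy := (hv.mul hv).pdy.continuous
    have cWxy := (hv.mul hv).pdx.pdy.continuous
    refine setIntegral_mono (integrableOn_sq2 (by fun_prop)) (integrableOn_sq2 (by fun_prop))
      fun q => ?_
    rw [pdx_mul hv hv, pdy_mul hv hv, pdy_add (hv.pdx.mul hv) (hv.mul hv.pdx),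
      pdy_mul hv.pdx hv, pdy_mul hv hv.pdx]
    simp only [Pi.add_apply, Pi.mul_apply]
    have e1 : pdy v q * v q + v q * pdy v q = 2 * (v q * pdy v q) := by ring
    have e2 : pdx v q * v q + v q * pdx v q = 2 * (v q * pdx v q) := by ring
    have e3 : pdy (pdx v) q * v q + pdx v q * pdy v q + (pdy v q * pdx v q
      + v q * pdy (pdx v) q) = 2 * (pdx v q * pdy v q) + 2 * (v q * pdy (pdx v) q) := by ring
    have e4 := abs_add_le (2 * (pdx v q * pdy v q)) (2 * (v q * pdy (pdx v) q))
    rw [e1, e2, e3]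
    simp only [abs_mul, abs_two] at e4 ⊢
    linarith
  refine (Eq.trans_le (by simp [sq]) (h.trans hle)).trans ?_
  rw [integral_sq2_add (by fun_prop) (by fun_prop), integral_sq2_add (by fun_prop) (by fun_prop),
    integral_sq2_add (by fun_prop) (by fun_prop), integral_sq2_add (by fun_prop) (by fun_prop)]
  simp only [integral_const_mul]
  simp only [l2inner, Pi.abs_apply] at b0 bx bY bxy bb
  linarith

lemma nat_mul_le_of_convex {b : ℕ → ℝ} (hb : ∀ j, 2 * b (j + 1) ≤ b j + b (j + 2))
    {j n : ℕ} (hjn : j ≤ n) : n * b j ≤ (n - j) * b 0 + j * b n := by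
  have step : ∀ j : ℕ, (j + 1) * b j ≤ b 0 + j * b (j + 1) := by
    intro j
    induction j with
    | zero => simp
    | succ j ih =>
      have := mul_le_mul_of_nonneg_left (hb j) (by positivity : (0 : ℝ) ≤ j + 1)
      push_cast
      linarith
  induction n, hjn using Nat.le_induction with
  | base => simp
  | succ n hjn ih =>
    rcases Nat.eq_zero_or_pos n with rfl | hn
    · obtain rfl : j = 0 := by omega
      simp
    · have hn' : (0 : ℝ) < n := by exact_mod_cast hn
      have h1 := mul_le_mul_of_nonneg_left ih (by positivity : (0 : ℝ) ≤ n + 1)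
      have h2 := mul_le_mul_of_nonneg_left (step n) (by positivity : (0 : ℝ) ≤ j)
      refine le_of_mul_le_mul_left ?_ hn'
      push_cast
      linarith

lemma l2norm_mul_mul_le {f g h : ℝ × ℝ → ℝ} (hf : Continuous f) (hg : Continuous g)
    (hh : Continuous h) {S T : ℝ} (hfS : ∀ p ∈ sq2, f p ^ 2 ≤ S) (hgT : ∀ p ∈ sq2, g p ^ 2 ≤ T) :
    l2norm (fun p => f p * g p * h p) ^ 2 ≤ S * T * l2inner h h := by
  rw [l2norm, Real.sq_sqrt (integral_nonneg fun p => sq_nonneg _), l2inner, ← integral_const_mul]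
  refine setIntegral_mono_on (integrableOn_sq2 (((hf.mul hg).mul hh).pow 2))
    (integrableOn_sq2 (by fun_prop)) measurableSet_sq2 fun p hp => ?_
  calc (f p * g p * h p) ^ 2 = f p ^ 2 * g p ^ 2 * (h p * h p) := by ring
    _ ≤ S * T * (h p * h p) := by
      have hS : 0 ≤ S := (sq_nonneg _).trans (hfS p hp)
      gcongr
      · exact mul_self_nonneg _
      · exact hfS p hp
      · exact hgT p hp

/-- Gagliardo–Nirenberg type product estimate for three partial derivatives. -/
theorem stmt_4 (m : ℕ) (hm : 1 ≤ m) :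
    ∃ c > 0, ∀ m₁ m₂ m₃ m₁₁ m₁₂ m₂₁ m₂₂ m₃₁ m₃₂ : ℕ,
      m₁₁ + m₁₂ = m₁ → m₂₁ + m₂₂ = m₂ → m₃₁ + m₃₂ = m₃ → m₁ + m₂ + m₃ + 2 ≤ 2 * m →
      ∀ u : ℝ × ℝ → ℝ, SmoothPeriodic u →
        l2norm (fun p => pdx^[m₁₁] (pdy^[m₁₂] u) p * pdx^[m₂₁] (pdy^[m₂₂] u) p *
            pdx^[m₃₁] (pdy^[m₃₂] u) p) ≤
          c * l2norm (Aop^[m + 1] u) ^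
              ((((m₁ : ℝ) + (m₂ : ℝ) + (m₃ : ℝ)) + 2) / (2 * ((m : ℝ) + 1))) *
            l2norm u ^
              ((6 * (m : ℝ) - ((m₁ : ℝ) + (m₂ : ℝ) + (m₃ : ℝ)) + 4) / (2 * ((m : ℝ) + 1))) := by
  refine ⟨9, by norm_num, ?_⟩
  intro m₁ m₂ m₃ m₁₁ m₁₂ m₂₁ m₂₂ m₃₁ m₃₂ h₁ h₂ h₃ hle u hu
  set a : ℕ → ℝ := fun j => sobolevForm j u u with ha
  have ha0 : ∀ j, 0 ≤ a j := fun j => sobolevForm_self_nonneg j u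
  have hsup : ∀ i k s : ℕ, i + k = s → ∀ p ∈ sq2,
      pdx^[i] (pdy^[k] u) p ^ 2 ≤ 9 * √(a s * a (s + 2)) := by
    rintro i k s rfl p hp
    refine (sq_le_sqrt_sobolevForm (hu.iterate i k) hp).trans ?_
    gcongr
    · exact sobolevForm_self_nonneg _ _
    · exact ha0 _
    · exact sobolevForm_iterate_le 0 i k u
    · exact sobolevForm_iterate_le 2 i k u
  have hprod := l2norm_mul_mul_le (hu.iterate m₁₁ m₁₂).continuous (hu.iterate m₂₁ m₂₂).continuous
    (hu.iterate m₃₁ m₃₂).continuous (hsup _ _ _ h₁) (hsup _ _ _ h₂)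
  have h3 : l2inner (pdx^[m₃₁] (pdy^[m₃₂] u)) (pdx^[m₃₁] (pdy^[m₃₂] u)) ≤ a m₃ :=
    h₃ ▸ sobolevForm_iterate_le 0 m₃₁ m₃₂ u
  set L := l2norm (fun p => pdx^[m₁₁] (pdy^[m₁₂] u) p * pdx^[m₂₁] (pdy^[m₂₂] u) p *
            pdx^[m₃₁] (pdy^[m₃₂] u) p)
  replace hprod := hprod.trans (mul_le_mul_of_nonneg_left h3 (by positivity))
  have hE : a 0 = l2norm u ^ 2 := sobolevForm_two_mul_self 0 hu
  have hM : a (2 * (m + 1)) = l2norm (Aop^[m + 1] u) ^ 2 := sobolevForm_two_mul_self (m + 1) hu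
  have hE0 : 0 ≤ l2norm u := Real.sqrt_nonneg _
  have hM0 : 0 ≤ l2norm (Aop^[m + 1] u) := Real.sqrt_nonneg _
  set E := l2norm u
  set M := l2norm (Aop^[m + 1] u)
  have hconv : ∀ j, a (j + 1) ^ 2 ≤ a j * a (j + 2) := fun j => sobolevForm_logConvex j hu
  rcases (ha0 0).eq_or_lt with h0 | hpos0
  · have hz : ∀ j, a j = 0 := by
      intro j
      induction j with
      | zero => exact h0.symm
      | succ j ih =>
        have := hconv j
        rw [ih, zero_mul] at this
        exact pow_eq_zero_iff (two_ne_zero) |>.1 (le_antisymm this (sq_nonneg _))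
    simp only [hz, mul_zero] at hprod
    have : L = 0 := pow_eq_zero_iff (two_ne_zero) |>.1 (le_antisymm hprod (sq_nonneg _))
    rw [this]
    positivity
  · have hpos : ∀ j, 0 < a j := by
      intro j
      induction j with
      | zero => exact hpos0
      | succ j ih => exact ih.trans_le (sobolevForm_le_succ j u)
    have hEp : 0 < E := hE0.lt_of_ne' fun h => by simp [h] at hE; exact hpos0.ne' hE
    have hMp : 0 < M := hM0.lt_of_ne' fun h => by
      rw [h] at hM; simp at hM; exact (hpos _).ne' hM
    have hlog : ∀ j, 2 * Real.log (a (j + 1)) ≤ Real.log (a j) + Real.log (a (j + 2)) := by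
      intro j
      rw [← Real.log_mul (hpos _).ne' (hpos _).ne']
      have := Real.log_le_log (pow_pos (hpos (j + 1)) 2) (hconv j)
      simpa using this
    have hint : ∀ j, j ≤ 2 * (m + 1) → (m + 1) * Real.log (a j) ≤
        (2 * (m + 1) - j) * Real.log E + j * Real.log M := by
      intro j hj
      have := nat_mul_le_of_convex (b := fun j => Real.log (a j)) hlog hj
      rw [hE, hM, Real.log_pow, Real.log_pow] at this
      push_cast at this
      linarith
    have hsq : √(a m₁ * a (m₁ + 2)) =
        Real.exp ((Real.log (a m₁) + Real.log (a (m₁ + 2))) / 2) := by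
      rw [Real.exp_half, Real.exp_add, Real.exp_log (hpos _), Real.exp_log (hpos _)]
    have hsq' : √(a m₂ * a (m₂ + 2)) =
        Real.exp ((Real.log (a m₂) + Real.log (a (m₂ + 2))) / 2) := by
      rw [Real.exp_half, Real.exp_add, Real.exp_log (hpos _), Real.exp_log (hpos _)]
    rw [Real.rpow_def_of_pos hEp, Real.rpow_def_of_pos hMp, mul_assoc, ← Real.exp_add]
    refine (sq_le_sq₀ (Real.sqrt_nonneg _) (by positivity)).1 (hprod.trans ?_)
    rw [hsq, hsq', ← Real.exp_log (hpos m₃), mul_pow, ← Real.exp_nat_mul]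
    have key : (Real.log (a m₁) + Real.log (a (m₁ + 2))) / 2
        + (Real.log (a m₂) + Real.log (a (m₂ + 2))) / 2 + Real.log (a m₃) ≤
        ((2 : ℕ) : ℝ) * (Real.log M * ((m₁ + m₂ + m₃ + 2) / (2 * (m + 1)))
          + Real.log E * ((6 * m - (m₁ + m₂ + m₃) + 4) / (2 * (m + 1)))) := by
      have hm1 : (0 : ℝ) < m + 1 := by positivity
      have e1 := hint m₁ (by omega)
      have e2 := hint (m₁ + 2) (by omega)
      have e3 := hint m₂ (by omega)
      have e4 := hint (m₂ + 2) (by omega)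
      have e5 := hint m₃ (by omega)
      refine le_of_mul_le_mul_left ?_ hm1
      have : (m + 1 : ℝ) * (((2 : ℕ) : ℝ) * (Real.log M * ((m₁ + m₂ + m₃ + 2) / (2 * (m + 1)))
          + Real.log E * ((6 * m - (m₁ + m₂ + m₃) + 4) / (2 * (m + 1))))) =
          Real.log M * (m₁ + m₂ + m₃ + 2) + Real.log E * (6 * m - (m₁ + m₂ + m₃) + 4) := by
        push_cast
        field_simp
      rw [this]
      push_cast at e2 e4
      linarith
    calc _ = 9 ^ 2 * Real.exp ((Real.log (a m₁) + Real.log (a (m₁ + 2))) / 2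
        + (Real.log (a m₂) + Real.log (a (m₂ + 2))) / 2 + Real.log (a m₃)) := by
          rw [Real.exp_add, Real.exp_add]; ring
      _ ≤ _ := by gcongr
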